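/- arXiv:1211.6595 — 8 statements merged into one kernel-verified Lean document; each statement's English description precedes it below -/
import Mathlib

section
/- Let k be a field of characteristic zero, S a monoid, C a coalgebra over k, and φ : k[S] → C a surjective morphism of k-coalgebras from the monoid algebra k[S] (equipped with its standard coalgebra structure, in which the comultiplication sends each basis element s ∈ S to s ⊗ s and the counit sends it to 1). Then the group-like elements of C are exactly the images φ(s) for s ∈ S; that is, c ∈ C satisfies Δ(c) = c ⊗ c and ε(c) = 1 if and only if c = φ(s) for some s ∈ S. -/
/-- In a coalgebra over a field, a group-like element lying in the span of a set of group-like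
elements belongs to that set. -/
theorem IsGroupLikeElem.mem_of_mem_span {k C : Type*} [Field k] [AddCommGroup C] [Module k C]
    [Coalgebra k C] {T : Set C} (hT : ∀ t ∈ T, IsGroupLikeElem k t) {c : C}
    (hc : IsGroupLikeElem k c) (hcT : c ∈ Submodule.span k T) : c ∈ T := by
  by_contra hmem
  have hli : LinearIndepOn k id (insert c T) :=
    linearIndepOn_isGroupLikeElem.mono (Set.insert_subset hc hT)
  exact ((linearIndepOn_id_insert hmem).1 hli).2 hcT

/-- The basis elements of the coalgebra `S →₀ k` are group-like. -/
theorem Finsupp.isGroupLikeElem_single_one (k : Type*) [Field k] {S : Type*} (s : S) :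
    IsGroupLikeElem k (Finsupp.single s (1 : k)) where
  counit_eq_one := by simp
  comul_eq_tmul_self := by simp

/-- Let `k` be a field of characteristic zero, `S` a monoid, `C` a `k`-coalgebra and
`φ : k[S] → C` a surjective coalgebra morphism from the monoid algebra `S →₀ k`
(with its standard coalgebra structure in which every `single s 1`, `s ∈ S`, is
group-like).  Then the group-like elements of `C` are exactly the images
`φ (single s 1)` for `s ∈ S`. -/
theorem groupLike_of_quotient_of_monoidAlgebra
    {k : Type*} [Field k] [CharZero k] {S : Type*} [Monoid S]
    {C : Type*} [AddCommGroup C] [Module k C] [Coalgebra k C]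
    (φ : (S →₀ k) →ₗc[k] C) (hφ : Function.Surjective φ) (c : C) :
    (Coalgebra.comul (R := k) c = c ⊗ₜ[k] c ∧ Coalgebra.counit (R := k) c = 1) ↔
      ∃ s : S, c = φ (Finsupp.single s 1) := by
  constructor
  · rintro ⟨hcomul, hcounit⟩
    have hspan : c ∈ Submodule.span k (Set.range fun s : S => φ (Finsupp.single s 1)) := by
      obtain ⟨x, rfl⟩ := hφ c
      clear hcomul hcounit
      induction x using Finsupp.induction_linear with
      | zero => simp
      | add x y hx hy => simpa using add_mem hx hy
      | single s a =>
        have h : φ (Finsupp.single s a) = a • φ (Finsupp.single s 1) := by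
          rw [← map_smul, Finsupp.smul_single_one]
        rw [h]
        exact Submodule.smul_mem _ a (Submodule.subset_span ⟨s, rfl⟩)
    obtain ⟨s, hs⟩ := IsGroupLikeElem.mem_of_mem_span
      (Set.forall_mem_range.2 fun s => (Finsupp.isGroupLikeElem_single_one k s).map φ)
      ⟨hcounit, hcomul⟩ hspan
    exact ⟨s, hs.symm⟩
  · rintro ⟨s, rfl⟩
    have h := (Finsupp.isGroupLikeElem_single_one k s).map φ
    exact ⟨h.comul_eq_tmul_self, h.counit_eq_one⟩
end

section
/- Let S be a finite bounded join-semilattice, i.e. a finite semilattice with join operation ⊔ and least element ⊥ (so (S, ⊔, ⊥) is a finite commutative idempotent monoid). A character of S is a function χ : S → ℂ such that χ(a ⊔ b) = χ(a)·χ(b) for all a, b ∈ S and χ(⊥) = 1. Then the family of evaluation functions (ev_s)_{s ∈ S}, where ev_s maps each character χ of S to χ(s) ∈ ℂ, is linearly independent in the ℂ-vector space of all functions from the set of characters of S to ℂ. -/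
/-- A function on a finite partial order whose sums over all principal lower sets vanish is
zero. -/
theorem eq_zero_of_forall_sum_ite_le_eq_zero {S M : Type*} [Fintype S] [PartialOrder S]
    [DecidableLE S] [AddCommMonoid M] {g : S → M}
    (h : ∀ t, ∑ s, (if s ≤ t then g s else 0) = 0) (t : S) : g t = 0 := by
  induction t using WellFoundedLT.induction with
  | ind t ih =>
    have ht := h t
    rwa [Finset.sum_eq_single t, if_pos le_rfl] at ht
    · intro s _ hst
      split_ifs with hle
      · exact ih s (lt_of_le_of_ne hle hst)
      · rfl
    · exact fun hmem => absurd (Finset.mem_univ t) hmem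

/-- Let `S` be a finite bounded join-semilattice, i.e. a finite commutative idempotent
monoid `(S, ⊔, ⊥)`.  The evaluation functions `ev_s : χ ↦ χ s`, indexed by `s ∈ S`, on
the set of characters of `S` (functions `χ : S → ℂ` with `χ (a ⊔ b) = χ a * χ b` and
`χ ⊥ = 1`) are linearly independent over `ℂ`. -/
theorem evaluations_linearIndependent_of_finite_semilattice
    {S : Type*} [Fintype S] [SemilatticeSup S] [OrderBot S] :
    LinearIndependent ℂ
      (fun s : S =>
        fun χ : {χ : S → ℂ // (∀ a b : S, χ (a ⊔ b) = χ a * χ b) ∧ χ ⊥ = 1} =>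
          (χ : S → ℂ) s) := by
  classical
  refine Fintype.linearIndependent_iff.mpr fun g hg =>
    eq_zero_of_forall_sum_ite_le_eq_zero fun t => ?_
  have ht := congrFun hg ⟨fun s => if s ≤ t then 1 else 0, fun a b => by
    by_cases ha : a ≤ t <;> simp [ha], by simp⟩
  simpa [Finset.sum_apply] using ht
end

section
/- Let N̄ = WithBot ℕ under max and N̲ = WithTop (WithBot ℕ), and for n ∈ N̲ let f_n : N̄ → ℂ be given by f_n(m) = 1 if m ≤ n and 0 otherwise. Then: (i) the map n ↦ f_n is a bijection from N̲ onto the set of all characters of (N̄, max), i.e. the set of functions χ : N̄ → ℂ with χ(max(a,b)) = χ(a)χ(b) for all a, b ∈ N̄ and χ(⊥) = 1; and (ii) for all s, t ∈ N̲ one has f_s · f_t = f_{min(s,t)} pointwise, and f_{+∞} is the constant function 1. Consequently the monoid of characters of (N̄, max) under pointwise multiplication is isomorphic to the monoid (N̲, min) with identity +∞. -/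
/-- For `n ∈ N̲ = ℕ ∪ {−∞, +∞}`, the function `f_n : N̄ = ℕ ∪ {−∞} → ℂ` given by
`f_n m = 1` if `m ≤ n` and `0` otherwise. -/
noncomputable def fchar (n : WithTop (WithBot ℕ)) (m : WithBot ℕ) : ℂ :=
  if (m : WithTop (WithBot ℕ)) ≤ n then 1 else 0

lemma fchar_eq_one_iff {n : WithTop (WithBot ℕ)} {m : WithBot ℕ} :
    fchar n m = 1 ↔ (m : WithTop (WithBot ℕ)) ≤ n := by
  simp [fchar]

lemma fchar_top : fchar ⊤ = fun _ => 1 :=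
  funext fun _ => fchar_eq_one_iff.2 le_top

lemma fchar_bot (n : WithTop (WithBot ℕ)) : fchar n ⊥ = 1 :=
  fchar_eq_one_iff.2 bot_le

lemma fchar_max (n : WithTop (WithBot ℕ)) (a b : WithBot ℕ) :
    fchar n (max a b) = fchar n a * fchar n b := by
  simp only [fchar, WithTop.coe_max, max_le_iff, ite_zero_mul_ite_zero, mul_one]

lemma fchar_mul (s t : WithTop (WithBot ℕ)) : fchar s * fchar t = fchar (min s t) := by
  ext m
  simp only [fchar, Pi.mul_apply, le_min_iff, ite_zero_mul_ite_zero, mul_one]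

lemma fchar_injective : Function.Injective fchar := by
  intro s t hst
  refine WithTop.eq_of_forall_coe_le_iff fun m => ?_
  rw [← fchar_eq_one_iff, hst, fchar_eq_one_iff]

lemma exists_eq_fchar {χ : WithBot ℕ → ℂ} (hmax : ∀ a b, χ (max a b) = χ a * χ b)
    (hbot : χ ⊥ = 1) : ∃ n, χ = fchar n := by
  have h_idem (a : WithBot ℕ) : χ a = 0 ∨ χ a = 1 := by
    have h := hmax a a
    rw [max_self] at h
    exact (IsIdempotentElem.iff_eq_zero_or_one (p := χ a)).1 h.symm
  by_cases hχ : ∃ m, χ m = 0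
  · obtain ⟨m, hm, hmin⟩ := wellFounded_lt.has_min {m | χ m = 0} hχ
    have hm_bot : ¬ IsMin m := by
      rw [isMin_iff_eq_bot]
      rintro rfl
      exact one_ne_zero (hbot.symm.trans hm)
    refine ⟨(Order.pred m : WithBot ℕ), funext fun a => ?_⟩
    simp only [fchar, WithTop.coe_le_coe, Order.le_pred_iff_of_not_isMin hm_bot]
    split_ifs with ha
    · exact (h_idem a).resolve_left fun h => hmin a h ha
    · rw [← max_eq_left (not_lt.1 ha), hmax, show χ m = 0 from hm, mul_zero]
  · push Not at hχ
    exact ⟨⊤, funext fun a => by rw [fchar_top, (h_idem a).resolve_left (hχ a)]⟩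

/-- `n ↦ f_n` is a bijection from `N̲` onto the set of characters of `(N̄, max)`;
moreover `f_s * f_t = f_{min s t}` pointwise and `f_{+∞} = 1`.  Consequently the monoid
of characters of `(N̄, max)` under pointwise multiplication is isomorphic to
`(N̲, min)` with identity `+∞`. -/
theorem fchar_bijection_and_min :
    (∀ n : WithTop (WithBot ℕ),
        (∀ a b : WithBot ℕ, fchar n (max a b) = fchar n a * fchar n b) ∧
        fchar n (⊥ : WithBot ℕ) = 1) ∧
    Function.Injective fchar ∧
    (∀ χ : WithBot ℕ → ℂ,
        (∀ a b : WithBot ℕ, χ (max a b) = χ a * χ b) → χ (⊥ : WithBot ℕ) = 1 →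
        ∃ n : WithTop (WithBot ℕ), χ = fchar n) ∧
    (∀ s t : WithTop (WithBot ℕ), fchar s * fchar t = fchar (min s t)) ∧
    fchar (⊤ : WithTop (WithBot ℕ)) = fun _ => 1 :=
  ⟨fun n => ⟨fchar_max n, fchar_bot n⟩, fchar_injective,
    fun _ => exists_eq_fchar, fchar_mul, fchar_top⟩
end

section
/- Let n ≥ 2 and let a_1, a_2, …, a_n ∈ ℂ satisfy a_n ≠ 0 and a_i ≠ a_{i+1} for every i with 1 ≤ i ≤ n−1. Then the n × n complex matrix M whose (i, j) entry is a_{max(i, j)} (so row i is (a_i, a_i, …, a_i, a_{i+1}, …, a_n), agreeing with a_{max(i,j)} in each column j) has nonzero determinant. -/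
/-- Let `n ≥ 2` and `a₁, …, aₙ ∈ ℂ` with `aₙ ≠ 0` and `aᵢ ≠ aᵢ₊₁` for all
`1 ≤ i ≤ n − 1`.  Then the `n × n` matrix `M = (a_{max(i,j)})` has nonzero
determinant. -/
theorem det_max_matrix_ne_zero (n : ℕ) (hn : 2 ≤ n) (a : Fin n → ℂ)
    (hlast : a ⟨n - 1, by omega⟩ ≠ 0)
    (hadj : ∀ i : ℕ, (h : i + 1 < n) → a ⟨i, by omega⟩ ≠ a ⟨i + 1, h⟩) :
    (Matrix.of fun i j : Fin n => a (max i j)).det ≠ 0 := by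
  intro hdet
  obtain ⟨v, hv, hMv⟩ := Matrix.exists_mulVec_eq_zero_iff.mpr hdet
  have hrow (i : Fin n) : ∑ j, a (max i j) * v j = 0 := congrFun hMv i
  refine hv (funext fun i => ?_)
  induction i using WellFoundedLT.induction with
  | ind i ih =>
    by_cases hi : (i : ℕ) + 1 < n
    · have hlt : i < ⟨i + 1, hi⟩ := Fin.lt_def.mpr (Nat.lt_succ_self i)
      have hdiff : ∑ j, (a (max i j) - a (max ⟨i + 1, hi⟩ j)) * v j = 0 := by
        simp only [sub_mul, Finset.sum_sub_distrib, hrow, sub_self]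
      rw [Finset.sum_eq_single i] at hdiff
      · rw [max_self, max_eq_left hlt.le] at hdiff
        exact (mul_eq_zero.mp hdiff).resolve_left (sub_ne_zero.mpr (hadj i hi))
      · intro j _ hji
        rcases hji.lt_or_gt with hj | hj
        · simp [ih j hj]
        · have hj' : (⟨i + 1, hi⟩ : Fin n) ≤ j := Fin.le_def.mpr (Fin.lt_def.mp hj)
          rw [max_eq_right hj.le, max_eq_right hj', sub_self, zero_mul]
      · simp
    · have hi_last : i = ⟨n - 1, by omega⟩ := Fin.ext (by simp only; omega)
      have hsum := hrow i
      rw [Finset.sum_eq_single i] at hsum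
      · rw [max_self] at hsum
        exact (mul_eq_zero.mp hsum).resolve_left (hi_last ▸ hlast)
      · intro j _ hji
        have hj : j < i := by
          refine lt_of_le_of_ne (Fin.le_def.mpr ?_) hji
          omega
        simp [ih j hj]
      · simp
end

section
/- Let N̄ = WithBot ℕ regarded as a monoid under max, and let f : N̄ → ℂ be any function. For n ∈ N̄ let n·f : N̄ → ℂ denote the translate m ↦ f(max(n, m)). Then the ℂ-linear span of the set of translates {n·f : n ∈ N̄} inside the vector space of functions N̄ → ℂ is finite-dimensional if and only if f is eventually constant on ℕ, i.e. there exists N ∈ ℕ such that f(m) = f(N) for every natural number m ≥ N. -/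
/-- The elements of a space `W` of functions on `WithBot ℕ` which vanish at all natural numbers
`m ≥ n`, as an increasing sequence of subspaces in `n`. -/
def vanishingFrom (W : Submodule ℂ (WithBot ℕ → ℂ)) : ℕ →o Submodule ℂ W where
  toFun n :=
    { carrier := {g | ∀ m : ℕ, n ≤ m → g.1 (m : WithBot ℕ) = 0}
      add_mem' := fun ha hb m hm => by simp [ha m hm, hb m hm]
      zero_mem' := fun m _ => by simp
      smul_mem' := fun c a ha m hm => by simp [ha m hm] }
  monotone' := fun _ _ h _ hg m hm => hg m (h.trans hm)

theorem mem_vanishingFrom {W : Submodule ℂ (WithBot ℕ → ℂ)} {n : ℕ} {g : W} :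
    g ∈ vanishingFrom W n ↔ ∀ m : ℕ, n ≤ m → g.1 (m : WithBot ℕ) = 0 :=
  Iff.rfl

theorem eventually_constant_of_finiteDimensional (f : WithBot ℕ → ℂ)
    (W : Submodule ℂ (WithBot ℕ → ℂ)) [FiniteDimensional ℂ W]
    (hW : ∀ n : WithBot ℕ, (fun m : WithBot ℕ => f (max n m)) ∈ W) :
    ∃ N : ℕ, ∀ m : ℕ, N ≤ m → f (m : WithBot ℕ) = f (N : WithBot ℕ) := by
  obtain ⟨N, hN⟩ := monotone_stabilizes_iff_noetherian.mpr
    (inferInstance : IsNoetherian ℂ W) (vanishingFrom W)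
  refine ⟨N, fun m hm => ?_⟩
  induction m, hm using Nat.le_induction with
  | base => rfl
  | succ k hk ih =>
    rw [← ih]
    let d : W := ⟨_, W.sub_mem (hW (k : WithBot ℕ)) (hW ((k + 1 : ℕ) : WithBot ℕ))⟩
    have hd : d ∈ vanishingFrom W (k + 1) := by
      refine mem_vanishingFrom.mpr fun m hm => ?_
      have h₁ : (k : WithBot ℕ) ≤ m := by exact_mod_cast (Nat.le_succ k).trans hm
      have h₂ : ((k + 1 : ℕ) : WithBot ℕ) ≤ m := by exact_mod_cast hm
      simp only [d, Pi.sub_apply, max_eq_right h₁, max_eq_right h₂, sub_self]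
    rw [← hN (k + 1) (hk.trans k.le_succ)] at hd
    have h := mem_vanishingFrom.mp hd k hk
    have hle : (k : WithBot ℕ) ≤ (k + 1 : ℕ) := by exact_mod_cast k.le_succ
    simp only [d, Pi.sub_apply, max_self, max_eq_left hle] at h
    exact (sub_eq_zero.mp h).symm

theorem finite_range_translates (f : WithBot ℕ → ℂ) (N : ℕ)
    (hf : ∀ m : ℕ, N ≤ m → f (m : WithBot ℕ) = f (N : WithBot ℕ)) :
    (Set.range fun n : WithBot ℕ => fun m : WithBot ℕ => f (max n m)).Finite := by
  have hf' : ∀ x : WithBot ℕ, (N : WithBot ℕ) ≤ x → f x = f (N : WithBot ℕ) := by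
    intro x hx
    induction x using WithBot.recBotCoe with
    | bot => simp at hx
    | coe m => exact hf m (WithBot.coe_le_coe.mp hx)
  refine ((Set.finite_Iic (N : WithBot ℕ)).image
    fun n : WithBot ℕ => fun m : WithBot ℕ => f (max n m)).subset ?_
  rintro _ ⟨n, rfl⟩
  rcases le_total n N with h | h
  · exact ⟨n, h, rfl⟩
  · refine ⟨N, Set.self_mem_Iic, funext fun m => ?_⟩
    exact (hf' _ (le_max_left _ _)).trans (hf' _ (h.trans (le_max_left _ _))).symm

/-- Let `f : N̄ → ℂ`, where `N̄ = ℕ ∪ {−∞}` is a monoid under `max`.  The span of the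
translates `n · f : m ↦ f (max n m)`, `n ∈ N̄`, is finite-dimensional if and only if
`f` is eventually constant on `ℕ`. -/
theorem translates_span_finiteDimensional_iff_eventually_constant
    (f : WithBot ℕ → ℂ) :
    FiniteDimensional ℂ
        (Submodule.span ℂ
          (Set.range fun n : WithBot ℕ => fun m : WithBot ℕ => f (max n m))) ↔
      ∃ N : ℕ, ∀ m : ℕ, N ≤ m → f (m : WithBot ℕ) = f (N : WithBot ℕ) := by
  constructor
  · intro h
    exact eventually_constant_of_finiteDimensional f _ fun n => 
      Submodule.subset_span (Set.mem_range_self n)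
  · rintro ⟨N, hN⟩
    exact FiniteDimensional.span_of_finite ℂ (finite_range_translates f N hN)
end

section
/- Let N̄ = WithBot ℕ and N̲ = WithTop (WithBot ℕ), and for n ∈ N̲ let f_n : N̄ → ℂ be given by f_n(m) = 1 if m ≤ n and 0 otherwise. If f : N̄ → ℂ is eventually constant on ℕ (there exists N ∈ ℕ with f(m) = f(N) for all natural m ≥ N), then f lies in the ℂ-linear span of the family {f_n : n ∈ N̲} inside the vector space of functions N̄ → ℂ. -/
theorem fchar_top_s10 (m : WithBot ℕ) : fchar ⊤ m = 1 := by
  simp [fchar]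

theorem fchar_coe (n m : WithBot ℕ) : fchar (n : WithTop (WithBot ℕ)) m = if m ≤ n then 1 else 0 := by
  simp [fchar]

theorem fchar_mem_span (n : WithTop (WithBot ℕ)) :
    fchar n ∈ Submodule.span ℂ (Set.range fchar) :=
  Submodule.subset_span ⟨n, rfl⟩

/-- Every function `f : N̄ → ℂ` that is eventually constant on `ℕ` lies in the span of
the group-like functions `f_n`, `n ∈ N̲`. -/
theorem eventually_constant_mem_span_fchar (f : WithBot ℕ → ℂ)
    (h : ∃ N : ℕ, ∀ m : ℕ, N ≤ m → f (m : WithBot ℕ) = f (N : WithBot ℕ)) :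
    f ∈ Submodule.span ℂ (Set.range fchar) := by
  obtain ⟨N, hN⟩ := h
  induction N generalizing f with
  | zero =>
    have hf : f = f (0 : ℕ) • fchar ⊤ + (f ⊥ - f (0 : ℕ)) • fchar ((⊥ : WithBot ℕ) : WithTop _) := by
      funext m
      simp only [Pi.add_apply, Pi.smul_apply, smul_eq_mul, fchar_top_s10, fchar_coe]
      induction m using WithBot.recBotCoe with
      | bot => simp
      | coe m =>
        simp only [le_bot_iff, WithBot.coe_ne_bot, if_false, mul_one, mul_zero, add_zero]
        exact hN m (Nat.zero_le m)
    rw [hf]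
    exact add_mem (Submodule.smul_mem _ _ (fchar_mem_span _))
      (Submodule.smul_mem _ _ (fchar_mem_span _))
  | succ N ih =>
    set c : ℂ := f (N : ℕ) - f ((N + 1 : ℕ) : WithBot ℕ) with hc
    set p := fchar ((N : WithBot ℕ) : WithTop (WithBot ℕ)) with hp
    have hp_mem : c • p ∈ Submodule.span ℂ (Set.range fchar) :=
      Submodule.smul_mem _ _ (fchar_mem_span _)
    have hg (m : ℕ) (hm : N ≤ m) : (f - c • p) (m : WithBot ℕ) = f ((N + 1 : ℕ) : WithBot ℕ) := by
      simp only [Pi.sub_apply, Pi.smul_apply, smul_eq_mul, hp, fchar_coe]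
      rcases hm.eq_or_lt with rfl | hlt
      · simp [hc]
      · have hle : ¬ (m : WithBot ℕ) ≤ (N : WithBot ℕ) := by
          exact_mod_cast hlt.not_ge
        simpa only [if_neg hle, mul_zero, sub_zero] using hN m hlt
    have hsub := ih (f - c • p) fun m hm => (hg m hm).trans (hg N le_rfl).symm
    simpa using add_mem hsub hp_mem
end

section
/- The monoids (N̄, max) and (N̲, min) are not isomorphic, where N̄ = WithBot ℕ is a commutative monoid under max with identity ⊥ = −∞ and N̲ = WithTop (WithBot ℕ) is a commutative monoid under min with identity +∞. That is, there exists no bijection e : N̄ → N̲ satisfying e(max(a, b)) = min(e(a), e(b)) for all a, b ∈ N̄. -/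
/-- The monoids `(N̄, max, ⊥)` and `(N̲, min, ⊤)` are not isomorphic: there is no
bijection `e : N̄ → N̲` with `e (max a b) = min (e a) (e b)` for all `a, b`. -/
theorem max_monoid_not_iso_min_monoid :
    ¬ ∃ e : WithBot ℕ → WithTop (WithBot ℕ),
        Function.Bijective e ∧
        ∀ a b : WithBot ℕ, e (max a b) = min (e a) (e b) := by
  rintro ⟨e, ⟨hinj, hsurj⟩, he⟩
  obtain ⟨a, ha⟩ := hsurj ⊥
  obtain ⟨b, hab⟩ := exists_gt a
  have h := he a b
  rw [max_eq_right hab.le, ha, bot_inf_eq, ← ha] at h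
  exact hab.ne' (hinj h)
end

section
/- Let S be a bounded join-semilattice, i.e. a semilattice with join ⊔ and least element ⊥, so that (S, ⊔, ⊥) is a commutative idempotent monoid, and let A be a unital ℂ-algebra graded by S: A = ⊕_{s ∈ S} A_s is an internal direct sum of subspaces with A_s · A_t ⊆ A_{s ⊔ t} for all s, t and 1 ∈ A_⊥. Then the monoid of characters of S acts on A by unital algebra endomorphisms: for each character χ (a function χ : S → ℂ with χ(a ⊔ b) = χ(a)χ(b) and χ(⊥) = 1), the linear map γ_χ(a) = Σ_s χ(s)·a_s is a unital ℂ-algebra endomorphism of A; moreover γ_{χ·η} = γ_χ ∘ γ_η for any two characters χ, η (pointwise product), and γ of the constant-one character is the identity of A. -/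
/-- For an `S`-graded algebra `A = ⊕ₛ Aₛ` and a function `f : S → ℂ`,
`gamma ℳ f a = ∑ₛ f s • aₛ` where `a = ∑ₛ aₛ` is the homogeneous decomposition. -/
noncomputable def gamma {S A : Type*} [DecidableEq S] [Ring A] [Algebra ℂ A]
    (ℳ : S → Submodule ℂ A) [DirectSum.Decomposition ℳ] (f : S → ℂ) (a : A) : A :=
  DirectSum.toAddMonoid (fun s => (f s • (ℳ s).subtype).toAddMonoidHom)
    (DirectSum.decompose ℳ a)

section gamma

variable {S A : Type*} [DecidableEq S] [Ring A] [Algebra ℂ A]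
  (ℳ : S → Submodule ℂ A) [DirectSum.Decomposition ℳ]

theorem gamma_of_mem (f : S → ℂ) {s : S} {a : A} (ha : a ∈ ℳ s) :
    gamma ℳ f a = f s • a := by
  simp [gamma, DirectSum.decompose_of_mem ℳ ha]

theorem gamma_zero (f : S → ℂ) : gamma ℳ f 0 = 0 := by
  simp [gamma]

theorem gamma_add (f : S → ℂ) (a b : A) :
    gamma ℳ f (a + b) = gamma ℳ f a + gamma ℳ f b := by
  simp [gamma]

theorem gamma_smul (f : S → ℂ) (c : ℂ) (a : A) :
    gamma ℳ f (c • a) = c • gamma ℳ f a := by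
  induction a using DirectSum.Decomposition.inductionOn ℳ with
  | zero => simp [gamma_zero]
  | homogeneous a =>
    rw [gamma_of_mem ℳ f a.2, gamma_of_mem ℳ f (Submodule.smul_mem _ c a.2), smul_comm]
  | add a b ha hb => rw [smul_add, gamma_add, gamma_add, ha, hb, smul_add]

theorem gamma_mul_apply (f g : S → ℂ) (a : A) :
    gamma ℳ (f * g) a = gamma ℳ f (gamma ℳ g a) := by
  induction a using DirectSum.Decomposition.inductionOn ℳ with
  | zero => simp [gamma_zero]
  | homogeneous a =>
    rw [gamma_of_mem ℳ _ a.2, gamma_of_mem ℳ g a.2, gamma_smul, gamma_of_mem ℳ f a.2,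
      smul_smul, Pi.mul_apply, mul_comm]
  | add a b ha hb => simp only [gamma_add, ha, hb]

theorem gamma_const_one (a : A) : gamma ℳ (fun _ => (1 : ℂ)) a = a := by
  induction a using DirectSum.Decomposition.inductionOn ℳ with
  | zero => exact gamma_zero ℳ _
  | homogeneous a => rw [gamma_of_mem ℳ _ a.2, one_smul]
  | add a b ha hb => rw [gamma_add, ha, hb]

theorem gamma_map_mul [SemilatticeSup S]
    (hmul : ∀ s t : S, ∀ a ∈ ℳ s, ∀ b ∈ ℳ t, a * b ∈ ℳ (s ⊔ t))
    {χ : S → ℂ} (hχ : ∀ s t : S, χ (s ⊔ t) = χ s * χ t) (a b : A) :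
    gamma ℳ χ (a * b) = gamma ℳ χ a * gamma ℳ χ b := by
  induction a using DirectSum.Decomposition.inductionOn ℳ with
  | zero => simp [gamma_zero]
  | add a a' ha ha' => rw [add_mul, gamma_add, gamma_add, ha, ha', add_mul]
  | @homogeneous s a =>
    induction b using DirectSum.Decomposition.inductionOn ℳ with
    | zero => simp [gamma_zero]
    | add b b' hb hb' => rw [mul_add, gamma_add, gamma_add, hb, hb', mul_add]
    | @homogeneous t b =>
      rw [gamma_of_mem ℳ χ a.2, gamma_of_mem ℳ χ b.2,
        gamma_of_mem ℳ χ (hmul s t a a.2 b b.2), hχ, smul_mul_smul_comm]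

end gamma

/-- If `S` is a bounded join-semilattice (a commutative idempotent monoid `(S, ⊔, ⊥)`) and
`A` is a unital `ℂ`-algebra graded by `S`, then the monoid of characters of `S` (the
Pontryagin dual of the discrete semilattice `S`) acts on `A` by unital algebra
endomorphisms `γ_χ : a ↦ ∑ₛ χ(s) • aₛ`. -/
theorem dualSemilatticeActsOnGradedAlgebra {S A : Type*} [DecidableEq S] [SemilatticeSup S] [OrderBot S]
    [Ring A] [Algebra ℂ A]
    (ℳ : S → Submodule ℂ A) [DirectSum.Decomposition ℳ]
    (hmul : ∀ s t : S, ∀ a ∈ ℳ s, ∀ b ∈ ℳ t, a * b ∈ ℳ (s ⊔ t))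
    (hone : (1 : A) ∈ ℳ (⊥ : S)) :
    (∀ χ : S → ℂ, (∀ a b : S, χ (a ⊔ b) = χ a * χ b) → χ ⊥ = 1 →
      ((∀ (c : ℂ) (a b : A),
          gamma ℳ χ (c • a + b) = c • gamma ℳ χ a + gamma ℳ χ b) ∧
       (∀ a b : A, gamma ℳ χ (a * b) = gamma ℳ χ a * gamma ℳ χ b) ∧
       gamma ℳ χ (1 : A) = 1)) ∧
    (∀ χ η : S → ℂ, (∀ a b : S, χ (a ⊔ b) = χ a * χ b) → χ ⊥ = 1 →
        (∀ a b : S, η (a ⊔ b) = η a * η b) → η ⊥ = 1 →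
        ∀ a : A, gamma ℳ (χ * η) a = gamma ℳ χ (gamma ℳ η a)) ∧
    (∀ a : A, gamma ℳ (fun _ => (1 : ℂ)) a = a) := by
  refine ⟨fun χ hχ hbot => ⟨fun c a b => ?_, gamma_map_mul ℳ hmul hχ, ?_⟩,
    fun χ η _ _ _ _ => gamma_mul_apply ℳ χ η, gamma_const_one ℳ⟩
  · rw [gamma_add, gamma_smul]
  · rw [gamma_of_mem ℳ χ hone, hbot, one_smul]
end
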